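/- Let n ≥ 2 and let A be an n×m integer matrix of rank n (over ℚ) with ‖A‖∞ ≥ 2. Then there exists an n×n integer matrix B with nonzero determinant whose columns generate the same ℤ-submodule of ℤⁿ as the columns of A (i.e. L(B) = L(A)) and whose entries satisfy ‖B‖∞ ≤ n²·‖A‖∞·log₂(n·‖A‖∞). -/

import Mathlib

/-- A sublattice of `ℤⁿ` containing `D • eᵢ` for all `i` is generated by `n` vectors whose entries
are bounded by `|D|`. -/
theorem exists_span_eq_of_single_mem {n : ℕ} (G : Submodule ℤ (Fin n → ℤ)) {D : ℤ} (hD : D ≠ 0)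
    (hG : ∀ i, Pi.single i D ∈ G) :
    ∃ y : Fin n → Fin n → ℤ, (∀ i j, |y i j| ≤ |D|) ∧ Submodule.span ℤ (Set.range y) = G := by
  have key : ∀ i : Fin n, ∃ y ∈ G, (∀ j, |y j| ≤ |D|) ∧ (∀ j, i < j → y j = 0) ∧
      ∀ x ∈ G, (∀ j, i < j → x j = 0) → y i ∣ x i := by
    intro i
    let H : Submodule ℤ (Fin n → ℤ) :=
      G ⊓ ⨅ j : {j // i < j}, LinearMap.ker (LinearMap.proj (R := ℤ) (φ := fun _ => ℤ) j.1)
    have hH : ∀ x, x ∈ H ↔ x ∈ G ∧ ∀ j, i < j → x j = 0 := by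
      intro x
      simp [H, Submodule.mem_iInf]
    let I : Ideal ℤ := H.map (LinearMap.proj i)
    obtain ⟨d, hd⟩ := (IsPrincipalIdealRing.principal I).principal
    have hdI : d ∈ I := by rw [hd]; exact Submodule.mem_span_singleton_self d
    have hdvd : ∀ x ∈ G, (∀ j, i < j → x j = 0) → d ∣ x i := by
      intro x hx hx0
      have : x i ∈ I := ⟨x, (hH x).2 ⟨hx, hx0⟩, rfl⟩
      rw [hd] at this
      exact Ideal.mem_span_singleton.1 this
    obtain ⟨z, hz, hzd⟩ := hdI
    obtain ⟨hzG, hz0⟩ := (hH z).1 hz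
    have hzd : z i = d := hzd
    have hdD : |d| ≤ |D| := by
      have := hdvd (Pi.single i D) (hG i) (fun j hj => by simp [hj.ne'])
      rw [Pi.single_eq_same] at this
      exact Int.le_of_dvd (abs_pos.2 hD) ((abs_dvd_abs _ _).2 this)
    refine ⟨z - ∑ j ∈ Finset.Iio i, (z j / D) • Pi.single j D, ?_, ?_⟩
    · exact G.sub_mem hzG (G.sum_mem fun j _ => G.smul_mem _ (hG j))
    have hval : ∀ k, (z - ∑ j ∈ Finset.Iio i, (z j / D) • Pi.single j D) k =
        if k < i then z k % D else z k := by
      intro k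
      have : (∑ j ∈ Finset.Iio i, (z j / D) • (Pi.single j D : Fin n → ℤ)) k =
          if k < i then z k / D * D else 0 := by
        simp [Finset.sum_apply, Pi.single_apply]
      rw [Pi.sub_apply, this]
      split_ifs
      · rw [Int.emod_def, mul_comm]
      · simp
    simp only [hval]
    refine ⟨fun j => ?_, fun j hj => ?_, fun x hx hx0 => ?_⟩
    · rcases lt_trichotomy j i with h | h | h
      · rw [if_pos h, abs_of_nonneg (Int.emod_nonneg _ hD)]
        exact (Int.emod_lt_abs _ hD).le
      · subst h; simpa [hzd] using hdD
      · simp [h.not_gt, hz0 j h]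
    · simp [hj.not_gt, hz0 j hj]
    · simpa [hzd] using hdvd x hx hx0
  choose y hyG hyD hy0 hydvd using key
  refine ⟨y, hyD, le_antisymm (Submodule.span_le.2 (Set.range_subset_iff.2 hyG)) ?_⟩
  have step : ∀ k : ℕ, ∀ x ∈ G, (∀ j : Fin n, k ≤ j → x j = 0) →
      x ∈ Submodule.span ℤ (Set.range y) := by
    intro k
    induction k with
    | zero =>
      intro x _ hx0
      have : x = 0 := funext fun j => hx0 j (Nat.zero_le _)
      simp [this]
    | succ k ih =>
      intro x hx hx0
      by_cases hk : k < n
      · obtain ⟨c, hc⟩ := hydvd ⟨k, hk⟩ x hx (fun j hj => hx0 j hj)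
        have hmem : y ⟨k, hk⟩ ∈ Submodule.span ℤ (Set.range y) := Submodule.subset_span ⟨_, rfl⟩
        have := ih (x - c • y ⟨k, hk⟩) (G.sub_mem hx (G.smul_mem _ (hyG _))) (fun j hj => by
          rcases hj.eq_or_lt with h | h
          · have : j = ⟨k, hk⟩ := Fin.ext h.symm
            subst this
            simp [hc, mul_comm]
          · simp [hx0 j h, hy0 ⟨k, hk⟩ j h])
        simpa using Submodule.add_mem _ this (Submodule.smul_mem _ c hmem)
      · exact ih x hx (fun j hj => absurd (hj.trans_lt j.2) hk)
  exact fun x hx => step n x hx fun j hj => absurd j.2 hj.not_gt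

/-- A sublattice of `ℤⁿ` containing the columns of a nonsingular matrix `M` is generated by `n`
vectors with entries bounded by `n` times a bound for the entries of `M`. -/
theorem exists_span_eq_of_col_mem {n : ℕ} (L : Submodule ℤ (Fin n → ℤ))
    (M : Matrix (Fin n) (Fin n) ℤ) (hM : M.det ≠ 0) (hL : ∀ j, M.col j ∈ L) {N : ℤ}
    (hN : ∀ i j, |M i j| ≤ N) :
    ∃ b : Fin n → Fin n → ℤ, (∀ i j, |b i j| ≤ n * N) ∧ Submodule.span ℤ (Set.range b) = L := by
  have hinj : Function.Injective M.cramer := by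
    intro x x' h
    have := congrArg (M.mulVec ·) h
    simp only [Matrix.mulVec_cramer] at this
    exact smul_right_injective _ hM this
  obtain ⟨y, hyD, hy⟩ := exists_span_eq_of_single_mem (L.map M.cramer) hM fun j =>
    ⟨M.col j, hL j, by
      have := M.transpose.cramer_transpose_row_self j
      simpa [Matrix.row, Matrix.col] using this⟩
  have hmem : ∀ i, ∃ b ∈ L, M.cramer b = y i := fun i => by
    have : y i ∈ L.map M.cramer := hy ▸ Submodule.subset_span ⟨i, rfl⟩
    exact this
  choose b hbL hb using hmem
  refine ⟨b, fun i j => ?_, Submodule.map_injective_of_injective hinj ?_⟩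
  · have h := congrFun (M.mulVec_cramer (b i)) j
    rw [hb, Pi.smul_apply, smul_eq_mul] at h
    refine le_of_mul_le_mul_left ?_ (abs_pos.2 hM)
    calc |M.det| * |b i j| = |∑ k, M j k * y i k| := by rw [← abs_mul, ← h]; rfl
      _ ≤ ∑ k, |M j k * y i k| := Finset.abs_sum_le_sum_abs _ _
      _ ≤ ∑ _k : Fin n, N * |M.det| := Finset.sum_le_sum fun k _ => by
        rw [abs_mul]
        exact mul_le_mul (hN j k) (hyD i k) (abs_nonneg _) ((abs_nonneg _).trans (hN j k))
      _ = |M.det| * (n * N) := by simp; ring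
  · rw [Submodule.map_span, ← Set.range_comp, ← hy]
    congr 2
    exact funext hb

/-- If the columns of a nonsingular matrix `M` lie in the lattice generated by the columns of a
square matrix `B`, then `B` is nonsingular. -/
theorem det_ne_zero_of_col_mem_span {n : ℕ} {M B : Matrix (Fin n) (Fin n) ℤ} (hM : M.det ≠ 0)
    (h : ∀ j, M.col j ∈ Submodule.span ℤ (Set.range B.transpose)) : B.det ≠ 0 := by
  have hc : ∀ j, ∃ c : Fin n → ℤ, B.mulVec c = M.col j := fun j => by
    obtain ⟨c, hc⟩ := (Submodule.mem_span_range_iff_exists_fun ℤ).1 (h j)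
    refine ⟨c, ?_⟩
    rw [Matrix.mulVec_eq_sum, ← hc]
    simp
  choose c hc using hc
  have hmul : M = B * (Matrix.of c).transpose := by
    ext i j
    exact (congrFun (hc j) i).symm
  rw [hmul, Matrix.det_mul] at hM
  exact left_ne_zero_of_mul hM

/-- An integer matrix of full row rank has a nonsingular maximal square submatrix. -/
theorem exists_submatrix_det_ne_zero {n m : ℕ} (A : Matrix (Fin n) (Fin m) ℤ)
    (hrank : (A.map (Int.cast : ℤ → ℚ)).rank = n) :
    ∃ e : Fin n → Fin m, (A.submatrix id e).det ≠ 0 := by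
  rw [Matrix.rank_eq_finrank_span_cols] at hrank
  have h := Submodule.exists_fun_fin_finrank_span_eq ℚ
    (Set.range (A.map (Int.cast : ℤ → ℚ)).col)
  rw [hrank] at h
  obtain ⟨f, hf, -, hli⟩ := h
  choose e he using hf
  refine ⟨e, fun h0 => ?_⟩
  have hcol : ((A.submatrix id e).map (Int.cast : ℤ → ℚ)).col = f := funext he
  rw [← hcol, Matrix.linearIndependent_cols_iff_isUnit, Matrix.isUnit_iff_isUnit_det] at hli
  refine hli.ne_zero ?_
  have := (Int.castRingHom ℚ).map_det (A.submatrix id e)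
  rw [h0, map_zero] at this
  exact this.symm


/-- Every full-rank integer matrix `A` (with `n ≥ 2`, `‖A‖∞ ≥ 2`) has a
lattice basis `B` with `L(B) = L(A)` and `‖B‖∞ ≤ n²·‖A‖∞·log₂(n·‖A‖∞)`. -/
theorem lattice_basis_with_small_entries
    (n m : ℕ) (hn : 2 ≤ n) (A : Matrix (Fin n) (Fin m) ℤ)
    (hrank : (A.map (Int.cast : ℤ → ℚ)).rank = n)
    (normA : ℕ)
    (hnormA : normA = Finset.univ.sup fun p : Fin n × Fin m => (A p.1 p.2).natAbs)
    (hA : 2 ≤ normA) :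
    ∃ B : Matrix (Fin n) (Fin n) ℤ,
      B.det ≠ 0 ∧
      Submodule.span ℤ (Set.range B.transpose) =
        Submodule.span ℤ (Set.range A.transpose) ∧
      ∀ i j, (|B i j| : ℝ) ≤
        (n : ℝ) ^ 2 * (normA : ℝ) * Real.logb 2 ((n : ℝ) * (normA : ℝ)) := by
  obtain ⟨e, he⟩ := exists_submatrix_det_ne_zero A hrank
  have hcol : ∀ j, (A.submatrix id e).col j ∈ Submodule.span ℤ (Set.range A.transpose) :=
    fun j => Submodule.subset_span ⟨e j, rfl⟩
  have hentry : ∀ i j, |A.submatrix id e i j| ≤ (normA : ℤ) := fun i j => by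
    have := Finset.le_sup (f := fun p : Fin n × Fin m => (A p.1 p.2).natAbs)
      (Finset.mem_univ (i, e j))
    rw [← hnormA] at this
    rw [Int.abs_eq_natAbs]
    exact_mod_cast this
  obtain ⟨b, hb, hspan⟩ := exists_span_eq_of_col_mem _ _ he hcol hentry
  refine ⟨(Matrix.of b).transpose, det_ne_zero_of_col_mem_span he ?_, hspan, fun i j => ?_⟩
  · intro j
    have := hcol j
    rwa [← hspan] at this
  have hnR : (2 : ℝ) ≤ n := by exact_mod_cast hn
  have hAR : (2 : ℝ) ≤ normA := by exact_mod_cast hA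
  have hlog : 1 ≤ Real.logb 2 ((n : ℝ) * normA) := by
    rw [Real.le_logb_iff_rpow_le one_lt_two (by positivity), Real.rpow_one]
    nlinarith
  have hbR : (|b j i| : ℝ) ≤ n * normA := by exact_mod_cast hb j i
  calc (|b j i| : ℝ) ≤ n * normA := hbR
    _ ≤ (n : ℝ) ^ 2 * normA := by gcongr; nlinarith
    _ ≤ (n : ℝ) ^ 2 * normA * Real.logb 2 (n * normA) := le_mul_of_one_le_right (by positivity) hlog
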